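/- arXiv:2108.03312 — 2 statements merged into one kernel-verified Lean document; each statement's English description precedes it below -/
import Mathlib

section
/- Let C_A ∈ ℂ^{n×n} and C_B ∈ ℂ^{m×m} be circulant matrices and S_A ∈ ℂ^{n×n} and S_B ∈ ℂ^{m×m} be skew-circulant matrices. Suppose that one of the four matrices C_A, C_B, S_A, S_B is positive definite and the other three are positive semi-definite. Set C̃ = I_m ⊗ C_A + C_Bᵀ ⊗ I_n and S̃ = I_m ⊗ S_A + S_Bᵀ ⊗ I_n. Then for every real γ > 0 the matrices γI + C̃ and γI + S̃ are invertible (I the identity of order mn) and the spectral radius of M_γ = (γI + S̃)^{−1}(γI − C̃)(γI + C̃)^{−1}(γI − S̃) satisfies ρ(M_γ) < 1. -/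
open Matrix Kronecker

/-- A matrix `C` is circulant if there are constants `c_{1-n}, …, c_{n-1}` with
`c_{-l} = c_{n-l}` for `l = 1, …, n-1` such that `C j k = c (j - k)`. -/
def IsCirculant {n : ℕ} (C : Matrix (Fin n) (Fin n) ℂ) : Prop :=
  ∃ c : ℤ → ℂ, (∀ l : ℤ, 1 ≤ l → l ≤ (n : ℤ) - 1 → c (-l) = c ((n : ℤ) - l)) ∧
    ∀ j k : Fin n, C j k = c ((j : ℤ) - (k : ℤ))

/-- A matrix `S` is skew-circulant if there are constants `s_{1-n}, …, s_{n-1}` with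
`s_{-l} = -s_{n-l}` for `l = 1, …, n-1` such that `S j k = s (j - k)`. -/
def IsSkewCirculant {n : ℕ} (S : Matrix (Fin n) (Fin n) ℂ) : Prop :=
  ∃ s : ℤ → ℂ, (∀ l : ℤ, 1 ≤ l → l ≤ (n : ℤ) - 1 → s (-l) = - s ((n : ℤ) - l)) ∧
    ∀ j k : Fin n, S j k = s ((j : ℤ) - (k : ℤ))

/-- `K` is positive definite (in the general, not necessarily Hermitian, sense):
`Re (x* K x) > 0` for every nonzero `x`. -/
def IsPosDefRe {N : Type*} [Fintype N] (K : Matrix N N ℂ) : Prop :=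
  ∀ x : N → ℂ, x ≠ 0 → 0 < (star x ⬝ᵥ K.mulVec x).re

/-- `K` is positive semi-definite (in the general, not necessarily Hermitian, sense):
`Re (x* K x) ≥ 0` for every `x`. -/
def IsPosSemidefRe {N : Type*} [Fintype N] (K : Matrix N N ℂ) : Prop :=
  ∀ x : N → ℂ, 0 ≤ (star x ⬝ᵥ K.mulVec x).re

/-- The difference of the squared lengths of `γ x + K x` and `γ x - K x`. -/
theorem re_dotProduct_star_add_eq_sub {N : Type*} [Fintype N] (K : Matrix N N ℂ) (γ : ℝ)
    (x : N → ℂ) :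
    (star ((γ : ℂ) • x + K *ᵥ x) ⬝ᵥ ((γ : ℂ) • x + K *ᵥ x)).re =
      (star ((γ : ℂ) • x - K *ᵥ x) ⬝ᵥ ((γ : ℂ) • x - K *ᵥ x)).re +
        4 * γ * (star x ⬝ᵥ K *ᵥ x).re := by
  have hconj : (star (K *ᵥ x) ⬝ᵥ x).re = (star x ⬝ᵥ K *ᵥ x).re := by
    rw [star_dotProduct, Complex.star_def, Complex.conj_re]
  simp only [star_add, star_sub, star_smul, add_dotProduct, sub_dotProduct, dotProduct_add,
    dotProduct_sub, smul_dotProduct, dotProduct_smul, Complex.add_re, Complex.sub_re,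
    Complex.star_def, Complex.conj_ofReal, smul_eq_mul, Complex.re_ofReal_mul, hconj]
  ring

open scoped ComplexOrder in
theorem re_dotProduct_star_self_pos {N : Type*} [Fintype N] {x : N → ℂ} (hx : x ≠ 0) :
    0 < (star x ⬝ᵥ x).re :=
  (Complex.lt_def.1 (dotProduct_star_self_pos_iff.2 hx)).1

theorem re_dotProduct_star_smul_self {N : Type*} [Fintype N] (μ : ℂ) (x : N → ℂ) :
    (star (μ • x) ⬝ᵥ (μ • x)).re = ‖μ‖ ^ 2 * (star x ⬝ᵥ x).re := by
  rw [star_smul, smul_dotProduct, dotProduct_smul, smul_eq_mul, smul_eq_mul, ← mul_assoc,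
    Complex.star_def, ← Complex.normSq_eq_conj_mul_self, Complex.re_ofReal_mul,
    Complex.normSq_eq_norm_sq]

theorem IsPosDefRe.isPosSemidefRe {N : Type*} [Fintype N] {K : Matrix N N ℂ}
    (hK : IsPosDefRe K) : IsPosSemidefRe K := fun x => by
  rcases eq_or_ne x 0 with rfl | hx
  · simp
  · exact (hK x hx).le

theorem IsPosSemidefRe.add {N : Type*} [Fintype N] {K L : Matrix N N ℂ}
    (hK : IsPosSemidefRe K) (hL : IsPosSemidefRe L) : IsPosSemidefRe (K + L) := fun x => by
  rw [add_mulVec, dotProduct_add, Complex.add_re]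
  exact add_nonneg (hK x) (hL x)

theorem IsPosDefRe.add_isPosSemidefRe {N : Type*} [Fintype N] {K L : Matrix N N ℂ}
    (hK : IsPosDefRe K) (hL : IsPosSemidefRe L) : IsPosDefRe (K + L) := fun x hx => by
  rw [add_mulVec, dotProduct_add, Complex.add_re]
  exact add_pos_of_pos_of_nonneg (hK x hx) (hL x)

theorem IsPosSemidefRe.add_isPosDefRe {N : Type*} [Fintype N] {K L : Matrix N N ℂ}
    (hK : IsPosSemidefRe K) (hL : IsPosDefRe L) : IsPosDefRe (K + L) :=
  add_comm K L ▸ hL.add_isPosSemidefRe hK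

theorem star_dotProduct_transpose_mulVec {N : Type*} [Fintype N] (K : Matrix N N ℂ)
    (x : N → ℂ) : star x ⬝ᵥ Kᵀ *ᵥ x = star (star x) ⬝ᵥ K *ᵥ star x := by
  rw [star_star, dotProduct_mulVec, vecMul_transpose, dotProduct_comm]

theorem IsPosSemidefRe.transpose {N : Type*} [Fintype N] {K : Matrix N N ℂ}
    (hK : IsPosSemidefRe K) : IsPosSemidefRe Kᵀ := fun x => by
  rw [star_dotProduct_transpose_mulVec]
  exact hK (star x)

theorem IsPosDefRe.transpose {N : Type*} [Fintype N] {K : Matrix N N ℂ}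
    (hK : IsPosDefRe K) : IsPosDefRe Kᵀ := fun x hx => by
  rw [star_dotProduct_transpose_mulVec]
  exact hK (star x) (star_ne_zero.2 hx)

theorem star_dotProduct_one_kronecker_mulVec {M N : Type*} [Fintype M] [Fintype N]
    [DecidableEq M] (K : Matrix N N ℂ) (x : M × N → ℂ) :
    star x ⬝ᵥ ((1 : Matrix M M ℂ) ⊗ₖ K) *ᵥ x =
      ∑ i, star (fun j => x (i, j)) ⬝ᵥ K *ᵥ fun j => x (i, j) := by
  simp [dotProduct, mulVec, Fintype.sum_prod_type, kroneckerMap_apply, one_apply, ite_mul]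

theorem star_dotProduct_kronecker_one_mulVec {M N : Type*} [Fintype M] [Fintype N]
    [DecidableEq N] (K : Matrix M M ℂ) (x : M × N → ℂ) :
    star x ⬝ᵥ (K ⊗ₖ (1 : Matrix N N ℂ)) *ᵥ x =
      ∑ j, star (fun i => x (i, j)) ⬝ᵥ K *ᵥ fun i => x (i, j) := by
  simp only [dotProduct, mulVec, Fintype.sum_prod_type, kroneckerMap_apply, one_apply, mul_ite,
    mul_one, mul_zero, ite_mul, zero_mul, Finset.sum_ite_eq, Finset.mem_univ, if_true,
    Pi.star_apply]
  exact Finset.sum_comm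

theorem IsPosSemidefRe.one_kronecker {M N : Type*} [Fintype M] [Fintype N] [DecidableEq M]
    {K : Matrix N N ℂ} (hK : IsPosSemidefRe K) :
    IsPosSemidefRe ((1 : Matrix M M ℂ) ⊗ₖ K) := fun x => by
  rw [star_dotProduct_one_kronecker_mulVec, Complex.re_sum]
  exact Finset.sum_nonneg fun i _ => hK _

theorem IsPosSemidefRe.kronecker_one {M N : Type*} [Fintype M] [Fintype N] [DecidableEq N]
    {K : Matrix M M ℂ} (hK : IsPosSemidefRe K) :
    IsPosSemidefRe (K ⊗ₖ (1 : Matrix N N ℂ)) := fun x => by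
  rw [star_dotProduct_kronecker_one_mulVec, Complex.re_sum]
  exact Finset.sum_nonneg fun j _ => hK _

theorem IsPosDefRe.one_kronecker {M N : Type*} [Fintype M] [Fintype N] [DecidableEq M]
    {K : Matrix N N ℂ} (hK : IsPosDefRe K) :
    IsPosDefRe ((1 : Matrix M M ℂ) ⊗ₖ K) := fun x hx => by
  rw [star_dotProduct_one_kronecker_mulVec, Complex.re_sum]
  obtain ⟨⟨i, j⟩, hij⟩ := Function.ne_iff.1 hx
  exact Finset.sum_pos' (fun i _ => hK.isPosSemidefRe _)
    ⟨i, Finset.mem_univ i, hK _ fun h => hij (congrFun h j)⟩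

theorem IsPosDefRe.kronecker_one {M N : Type*} [Fintype M] [Fintype N] [DecidableEq N]
    {K : Matrix M M ℂ} (hK : IsPosDefRe K) :
    IsPosDefRe (K ⊗ₖ (1 : Matrix N N ℂ)) := fun x hx => by
  rw [star_dotProduct_kronecker_one_mulVec, Complex.re_sum]
  obtain ⟨⟨i, j⟩, hij⟩ := Function.ne_iff.1 hx
  exact Finset.sum_pos' (fun j _ => hK.isPosSemidefRe _)
    ⟨j, Finset.mem_univ j, hK _ fun h => hij (congrFun h i)⟩

theorem IsPosSemidefRe.isUnit_smul_one_add {N : Type*} [Fintype N] [DecidableEq N]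
    {K : Matrix N N ℂ} (hK : IsPosSemidefRe K) {γ : ℝ} (hγ : 0 < γ) :
    IsUnit ((γ : ℂ) • (1 : Matrix N N ℂ) + K) := by
  rw [← mulVec_injective_iff_isUnit]
  refine (injective_iff_map_eq_zero ((γ : ℂ) • (1 : Matrix N N ℂ) + K).mulVecLin).2 fun x hx => ?_
  by_contra hne
  have h := congrArg (fun y => (star x ⬝ᵥ y).re) hx
  simp only [mulVecLin_apply, add_mulVec, smul_mulVec, one_mulVec, dotProduct_add,
    dotProduct_smul, smul_eq_mul, Complex.add_re, Complex.re_ofReal_mul, dotProduct_zero,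
    Complex.zero_re] at h
  have := mul_pos hγ (re_dotProduct_star_self_pos hne)
  linarith [hK x]

theorem spectralRadius_lt_one_of_forall_norm_lt_one {N : Type*} [Fintype N] [DecidableEq N]
    {K : Matrix N N ℂ} (hK : ∀ μ ∈ spectrum ℂ K, ‖μ‖ < 1) : spectralRadius ℂ K < 1 := by
  have hfin : (spectrum ℂ K).Finite := K.finite_spectrum
  have hsup : spectralRadius ℂ K = hfin.toFinset.sup fun μ => (‖μ‖₊ : ENNReal) := by
    simp [spectralRadius, Finset.sup_eq_iSup]
  rw [hsup, Finset.sup_lt_iff (by simp)]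
  intro μ hμ
  exact_mod_cast hK μ (hfin.mem_toFinset.1 hμ)

/-- Alternating-direction iterations with two positive semi-definite parts converge if one of
the parts is positive definite. -/
theorem spectralRadius_alternating_lt_one {N : Type*} [Fintype N] [DecidableEq N]
    {C S : Matrix N N ℂ} (hC : IsPosSemidefRe C) (hS : IsPosSemidefRe S)
    (hpd : IsPosDefRe C ∨ IsPosDefRe S) {γ : ℝ} (hγ : 0 < γ) :
    spectralRadius ℂ (((γ : ℂ) • (1 : Matrix N N ℂ) + S)⁻¹ * ((γ : ℂ) • (1 : Matrix N N ℂ) - C) *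
      ((γ : ℂ) • (1 : Matrix N N ℂ) + C)⁻¹ * ((γ : ℂ) • (1 : Matrix N N ℂ) - S)) < 1 := by
  refine spectralRadius_lt_one_of_forall_norm_lt_one fun μ hμ => ?_
  have hCu := (isUnit_iff_isUnit_det _).1 (hC.isUnit_smul_one_add hγ)
  have hSu := (isUnit_iff_isUnit_det _).1 (hS.isUnit_smul_one_add hγ)
  rw [← spectrum_toLin', ← Module.End.hasEigenvalue_iff_mem_spectrum] at hμ
  obtain ⟨x, hx⟩ := hμ.exists_hasEigenvector
  have hne : x ≠ 0 := hx.2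
  have hμx := hx.apply_eq_smul
  rw [toLin'_apply, ← mulVec_mulVec, ← mulVec_mulVec, ← mulVec_mulVec] at hμx
  obtain ⟨z, hz⟩ : ∃ z, z = ((γ : ℂ) • (1 : Matrix N N ℂ) + C)⁻¹ *ᵥ
    (((γ : ℂ) • (1 : Matrix N N ℂ) - S) *ᵥ x) := ⟨_, rfl⟩
  rw [← hz] at hμx
  have hz' := congrArg (((γ : ℂ) • (1 : Matrix N N ℂ) + C) *ᵥ ·) hz
  have hμx' := congrArg (((γ : ℂ) • (1 : Matrix N N ℂ) + S) *ᵥ ·) hμx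
  simp only [mulVec_mulVec, mul_nonsing_inv_cancel_left _ _ hCu] at hz'
  simp only [mulVec_mulVec, mul_nonsing_inv_cancel_left _ _ hSu, mulVec_smul] at hμx'
  simp only [add_mulVec, sub_mulVec, smul_mulVec, one_mulVec] at hz' hμx'
  have hCz := re_dotProduct_star_add_eq_sub C γ z
  have hSx := re_dotProduct_star_add_eq_sub S γ x
  rw [hz', hμx', re_dotProduct_star_smul_self] at hCz
  have hxpos : 0 < (star ((γ : ℂ) • x + S *ᵥ x) ⬝ᵥ ((γ : ℂ) • x + S *ᵥ x)).re := by
    refine re_dotProduct_star_self_pos fun h => hne ?_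
    refine mulVec_injective_iff_isUnit.2 (hS.isUnit_smul_one_add hγ) ?_
    simpa only [add_mulVec, smul_mulVec, one_mulVec, mulVec_zero] using h
  rcases eq_or_ne z 0 with rfl | hzne
  · rw [smul_zero, mulVec_zero, sub_zero, eq_comm, smul_eq_zero] at hμx'
    rcases hμx' with rfl | h
    · simp
    · rw [h, dotProduct_zero] at hxpos
      exact absurd hxpos (lt_irrefl _)
  have hsum : 0 < γ * (star z ⬝ᵥ C *ᵥ z).re + γ * (star x ⬝ᵥ S *ᵥ x).re := by
    rw [← mul_add]
    refine mul_pos hγ ?_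
    rcases hpd with h | h
    · exact add_pos_of_pos_of_nonneg (h z hzne) (hS x)
    · exact add_pos_of_nonneg_of_pos (hC z) (h x hne)
  by_contra! hle
  nlinarith [mul_le_mul_of_nonneg_right (one_le_pow₀ hle : 1 ≤ ‖μ‖ ^ 2) hxpos.le]

theorem cscs_converges_of_one_posDef_three_posSemidef
    {n m : ℕ} (CA SA : Matrix (Fin n) (Fin n) ℂ) (CB SB : Matrix (Fin m) (Fin m) ℂ)
    (hCA : IsCirculant CA) (hCB : IsCirculant CB)
    (hSA : IsSkewCirculant SA) (hSB : IsSkewCirculant SB)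
    (hpd :
      (IsPosDefRe CA ∧ IsPosSemidefRe CB ∧ IsPosSemidefRe SA ∧ IsPosSemidefRe SB) ∨
      (IsPosSemidefRe CA ∧ IsPosDefRe CB ∧ IsPosSemidefRe SA ∧ IsPosSemidefRe SB) ∨
      (IsPosSemidefRe CA ∧ IsPosSemidefRe CB ∧ IsPosDefRe SA ∧ IsPosSemidefRe SB) ∨
      (IsPosSemidefRe CA ∧ IsPosSemidefRe CB ∧ IsPosSemidefRe SA ∧ IsPosDefRe SB))
    (Ct St : Matrix (Fin m × Fin n) (Fin m × Fin n) ℂ)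
    (hCt : Ct = (1 : Matrix (Fin m) (Fin m) ℂ) ⊗ₖ CA + CBᵀ ⊗ₖ (1 : Matrix (Fin n) (Fin n) ℂ))
    (hSt : St = (1 : Matrix (Fin m) (Fin m) ℂ) ⊗ₖ SA + SBᵀ ⊗ₖ (1 : Matrix (Fin n) (Fin n) ℂ))
    (γ : ℝ) (hγ : 0 < γ) :
    IsUnit ((γ : ℂ) • (1 : Matrix (Fin m × Fin n) (Fin m × Fin n) ℂ) + Ct) ∧
    IsUnit ((γ : ℂ) • (1 : Matrix (Fin m × Fin n) (Fin m × Fin n) ℂ) + St) ∧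
    spectralRadius ℂ
        (((γ : ℂ) • (1 : Matrix (Fin m × Fin n) (Fin m × Fin n) ℂ) + St)⁻¹ *
          ((γ : ℂ) • (1 : Matrix (Fin m × Fin n) (Fin m × Fin n) ℂ) - Ct) *
          ((γ : ℂ) • (1 : Matrix (Fin m × Fin n) (Fin m × Fin n) ℂ) + Ct)⁻¹ *
          ((γ : ℂ) • (1 : Matrix (Fin m × Fin n) (Fin m × Fin n) ℂ) - St)) < 1 := by
  subst hCt hSt
  have kroneckerSum {A : Matrix (Fin n) (Fin n) ℂ} {B : Matrix (Fin m) (Fin m) ℂ}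
      (hA : IsPosSemidefRe A) (hB : IsPosSemidefRe B) :
      IsPosSemidefRe ((1 : Matrix (Fin m) (Fin m) ℂ) ⊗ₖ A +
        Bᵀ ⊗ₖ (1 : Matrix (Fin n) (Fin n) ℂ)) :=
    hA.one_kronecker.add hB.transpose.kronecker_one
  rcases hpd with ⟨h₁, h₂, h₃, h₄⟩ | ⟨h₁, h₂, h₃, h₄⟩ | ⟨h₁, h₂, h₃, h₄⟩ | ⟨h₁, h₂, h₃, h₄⟩
  · have h := kroneckerSum h₁.isPosSemidefRe h₂
    exact ⟨h.isUnit_smul_one_add hγ, (kroneckerSum h₃ h₄).isUnit_smul_one_add hγ,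
      spectralRadius_alternating_lt_one h (kroneckerSum h₃ h₄)
        (.inl (h₁.one_kronecker.add_isPosSemidefRe h₂.transpose.kronecker_one)) hγ⟩
  · have h := kroneckerSum h₁ h₂.isPosSemidefRe
    exact ⟨h.isUnit_smul_one_add hγ, (kroneckerSum h₃ h₄).isUnit_smul_one_add hγ,
      spectralRadius_alternating_lt_one h (kroneckerSum h₃ h₄)
        (.inl (h₁.one_kronecker.add_isPosDefRe h₂.transpose.kronecker_one)) hγ⟩
  · have h := kroneckerSum h₃.isPosSemidefRe h₄
    exact ⟨(kroneckerSum h₁ h₂).isUnit_smul_one_add hγ, h.isUnit_smul_one_add hγ,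
      spectralRadius_alternating_lt_one (kroneckerSum h₁ h₂) h
        (.inr (h₃.one_kronecker.add_isPosSemidefRe h₄.transpose.kronecker_one)) hγ⟩
  · have h := kroneckerSum h₃ h₄.isPosSemidefRe
    exact ⟨(kroneckerSum h₁ h₂).isUnit_smul_one_add hγ, h.isUnit_smul_one_add hγ,
      spectralRadius_alternating_lt_one (kroneckerSum h₁ h₂) h
        (.inr (h₃.one_kronecker.add_isPosDefRe h₄.transpose.kronecker_one)) hγ⟩
end

section
/- Let 0 ≤ θ_min ≤ θ_max and 0 ≤ η_min ≤ η_max be real numbers, Ω = [θ_min, θ_max] × [η_min, η_max], and for γ > 0 define f(γ) = max_{(θ,η) ∈ Ω} ((γ − θ)² + η²) / ((γ + θ)² + η²). Suppose η_max < √(θ_min(θ_max − θ_min)/2), and set γ* = √(θ_min θ_max − η_max²). Then γ* > 0, f(γ*) = (θ_min + θ_max − 2√(θ_min θ_max − η_max²)) / (θ_min + θ_max + 2√(θ_min θ_max − η_max²)), and f(γ) ≥ f(γ*) for every γ > 0; that is, the minimum over γ > 0 of f(γ) is attained at γ = γ*. -/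
/-- `rectMax θmin θmax ηmin ηmax γ` is
`max_{(θ,η) ∈ [θmin,θmax] × [ηmin,ηmax]} ((γ-θ)² + η²)/((γ+θ)² + η²)`. -/
noncomputable def rectMax (θmin θmax ηmin ηmax γ : ℝ) : ℝ :=
  ⨆ p ∈ Set.Icc θmin θmax ×ˢ Set.Icc ηmin ηmax,
    ((γ - p.1) ^ 2 + p.2 ^ 2) / ((γ + p.1) ^ 2 + p.2 ^ 2)

lemma ratio_nonneg (γ θ η : ℝ) :
    0 ≤ ((γ - θ) ^ 2 + η ^ 2) / ((γ + θ) ^ 2 + η ^ 2) := by positivity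

lemma ratio_le_one {γ θ : ℝ} (η : ℝ) (hγ : 0 < γ) (hθ : 0 ≤ θ) :
    ((γ - θ) ^ 2 + η ^ 2) / ((γ + θ) ^ 2 + η ^ 2) ≤ 1 := by
  rw [div_le_one (by positivity)]
  nlinarith [mul_nonneg hγ.le hθ]

lemma ratio_le_div_iff {γ θ η s t : ℝ} (hγ : 0 < γ) (hθ : 0 ≤ θ) (hs : 0 < s + 2 * t) :
    ((γ - θ) ^ 2 + η ^ 2) / ((γ + θ) ^ 2 + η ^ 2) ≤ (s - 2 * t) / (s + 2 * t) ↔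
      t * (γ ^ 2 + θ ^ 2 + η ^ 2) ≤ γ * θ * s := by
  rw [div_le_div_iff₀ (by positivity) hs]
  constructor <;> intro h <;> nlinarith

lemma div_le_ratio_iff {γ θ η s t : ℝ} (hγ : 0 < γ) (hθ : 0 ≤ θ) (hs : 0 < s + 2 * t) :
    (s - 2 * t) / (s + 2 * t) ≤ ((γ - θ) ^ 2 + η ^ 2) / ((γ + θ) ^ 2 + η ^ 2) ↔
      γ * θ * s ≤ t * (γ ^ 2 + θ ^ 2 + η ^ 2) := by
  rw [div_le_div_iff₀ hs (by positivity)]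
  constructor <;> intro h <;> nlinarith

lemma rectMax_le {θmin θmax ηmin ηmax γ C : ℝ} (hC : 0 ≤ C)
    (h : ∀ θ ∈ Set.Icc θmin θmax, ∀ η ∈ Set.Icc ηmin ηmax,
      ((γ - θ) ^ 2 + η ^ 2) / ((γ + θ) ^ 2 + η ^ 2) ≤ C) :
    rectMax θmin θmax ηmin ηmax γ ≤ C :=
  Real.iSup_le (fun p => Real.iSup_le (fun hp => h p.1 hp.1 p.2 hp.2) hC) hC

lemma ratio_le_rectMax {θmin θmax ηmin ηmax γ θ η : ℝ} (hθmin : 0 ≤ θmin) (hγ : 0 < γ)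
    (hθ : θ ∈ Set.Icc θmin θmax) (hη : η ∈ Set.Icc ηmin ηmax) :
    ((γ - θ) ^ 2 + η ^ 2) / ((γ + θ) ^ 2 + η ^ 2) ≤ rectMax θmin θmax ηmin ηmax γ := by
  have hmem : (θ, η) ∈ Set.Icc θmin θmax ×ˢ Set.Icc ηmin ηmax := ⟨hθ, hη⟩
  refine le_ciSup_of_le ⟨1, ?_⟩ (θ, η) ?_
  · rintro _ ⟨p, rfl⟩
    exact Real.iSup_le (fun hp => ratio_le_one _ hγ (hθmin.trans hp.1.1)) zero_le_one
  · rw [ciSup_pos hmem]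

theorem optimal_gamma_small_eta
    (θmin θmax ηmin ηmax : ℝ)
    (hθ0 : 0 ≤ θmin) (hθ : θmin ≤ θmax) (hη0 : 0 ≤ ηmin) (hη : ηmin ≤ ηmax)
    (hsmall : ηmax < Real.sqrt (θmin * (θmax - θmin) / 2))
    (γstar : ℝ) (hγstar : γstar = Real.sqrt (θmin * θmax - ηmax ^ 2)) :
    0 < γstar ∧
    rectMax θmin θmax ηmin ηmax γstar
      = (θmin + θmax - 2 * Real.sqrt (θmin * θmax - ηmax ^ 2)) /
        (θmin + θmax + 2 * Real.sqrt (θmin * θmax - ηmax ^ 2)) ∧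
    ∀ γ : ℝ, 0 < γ → rectMax θmin θmax ηmin ηmax γstar ≤ rectMax θmin θmax ηmin ηmax γ := by
  have hηmax : 0 ≤ ηmax := hη0.trans hη
  have hsq : ηmax ^ 2 < θmin * (θmax - θmin) / 2 := (Real.lt_sqrt hηmax).1 hsmall
  have hθmin : 0 < θmin := by
    refine hθ0.lt_of_ne fun h => ?_
    rw [← h] at hsq
    nlinarith [sq_nonneg ηmax]
  have hrad : 0 < θmin * θmax - ηmax ^ 2 := by nlinarith
  have hpos : 0 < γstar := hγstar ▸ Real.sqrt_pos.2 hrad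
  have hγsq : γstar ^ 2 = θmin * θmax - ηmax ^ 2 := hγstar ▸ Real.sq_sqrt hrad.le
  rw [← hγstar]
  have hs : 0 < θmin + θmax + 2 * γstar := by linarith
  have hmin : θmin ∈ Set.Icc θmin θmax := ⟨le_rfl, hθ⟩
  have hmax : θmax ∈ Set.Icc θmin θmax := ⟨hθ, le_rfl⟩
  have hηmem : ηmax ∈ Set.Icc ηmin ηmax := ⟨hη, le_rfl⟩
  have hratio : ∀ θ ∈ Set.Icc θmin θmax, ∀ η ∈ Set.Icc ηmin ηmax,
      ((γstar - θ) ^ 2 + η ^ 2) / ((γstar + θ) ^ 2 + η ^ 2) ≤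
        (θmin + θmax - 2 * γstar) / (θmin + θmax + 2 * γstar) := by
    intro θ hθm η hηm
    rw [ratio_le_div_iff hpos (hθ0.trans hθm.1) hs, mul_assoc]
    refine mul_le_mul_of_nonneg_left ?_ hpos.le
    have hη2 : η ^ 2 ≤ ηmax ^ 2 := pow_le_pow_left₀ (hη0.trans hηm.1) hηm.2 2
    nlinarith [mul_nonneg (sub_nonneg.2 hθm.1) (sub_nonneg.2 hθm.2)]
  have hupper := rectMax_le ((ratio_nonneg _ _ _).trans (hratio _ hmin _ hηmem)) hratio
  have hlower : ∀ γ : ℝ, 0 < γ →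
      (θmin + θmax - 2 * γstar) / (θmin + θmax + 2 * γstar) ≤
        rectMax θmin θmax ηmin ηmax γ := by
    intro γ hγ
    rcases le_total γ γstar with h | h
    · refine le_trans ?_ (ratio_le_rectMax hθ0 hγ hmax hηmem)
      rw [div_le_ratio_iff hγ (hθ0.trans hθ) hs]
      have hfac : (γ + γstar) * γstar ≤ θmax * (θmin + θmax) := by
        nlinarith [sq_nonneg ηmax]
      linear_combination
        mul_nonneg (sub_nonneg.2 h) (sub_nonneg.2 hfac) - γstar * hγsq
    · refine le_trans ?_ (ratio_le_rectMax hθ0 hγ hmin hηmem)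
      rw [div_le_ratio_iff hγ hθ0 hs]
      have hfac : θmin * (θmin + θmax) ≤ (γ + γstar) * γstar := by
        nlinarith
      linear_combination
        mul_nonneg (sub_nonneg.2 h) (sub_nonneg.2 hfac) - γstar * hγsq
  exact ⟨hpos, hupper.antisymm (hlower _ hpos), fun γ hγ => hupper.trans (hlower γ hγ)⟩
end
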